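/- The invariant feedback control law is invariant under the SE(2) action: fix any gain matrix L ∈ ℝ^{2×3}. Then for every reference state χ̄ = (x̄, ȳ, θ̄) ∈ ℝ³, every estimate χ̂ ∈ ℝ³, and every group element g = (x⁰, y⁰, θ⁰), one has L Υ_{−(θ̄+θ⁰)} (g·χ̂ − g·χ̄) = L Υ_{−θ̄} (χ̂ − χ̄); i.e., the control correction δu = L Υ_{−θ̄}(χ̂ − χ̄) is unchanged when both the reference state and the estimate are transformed by g. -/

import Mathlib

open Matrix

/-- `Υ_φ`: block-diagonal matrix with upper-left block the planar rotation `R_φ`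
and lower-right entry `1`. -/
noncomputable def Ups (φ : ℝ) : Matrix (Fin 3) (Fin 3) ℝ :=
  !![Real.cos φ, -Real.sin φ, 0;
     Real.sin φ,  Real.cos φ, 0;
     0,           0,          1]

/-- Action of `g = (x⁰, y⁰, θ⁰) ∈ ℝ² × ℝ` (SE(2)) on a state `(x, y, θ)`:
`g·χ = (x⁰, y⁰, 0) + Υ_{θ⁰} χ`. -/
noncomputable def act (g : (ℝ × ℝ) × ℝ) (χ : Fin 3 → ℝ) : Fin 3 → ℝ :=
  ![g.1.1, g.1.2, 0] + (Ups g.2).mulVec χ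

theorem Ups_mul (φ ψ : ℝ) : Ups φ * Ups ψ = Ups (φ + ψ) := by
  ext i j
  fin_cases i <;> fin_cases j <;>
    simp [Ups, Matrix.mul_apply, Fin.sum_univ_three, Real.cos_add, Real.sin_add] <;> ring

theorem act_sub_act (g : (ℝ × ℝ) × ℝ) (χ₁ χ₂ : Fin 3 → ℝ) :
    act g χ₁ - act g χ₂ = (Ups g.2).mulVec (χ₁ - χ₂) := by
  rw [act, act, add_sub_add_left_eq_sub, Matrix.mulVec_sub]

theorem invariant_feedback_control_invariant
    (L : Matrix (Fin 2) (Fin 3) ℝ)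
    (χbar χhat : Fin 3 → ℝ) (g : (ℝ × ℝ) × ℝ) :
    (L * Ups (-(χbar 2 + g.2))).mulVec (act g χhat - act g χbar) =
      (L * Ups (-(χbar 2))).mulVec (χhat - χbar) := by
  rw [act_sub_act, Matrix.mulVec_mulVec, Matrix.mul_assoc, Ups_mul, neg_add, neg_add_cancel_right]
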